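/- arXiv:math/0606087 — 3 statements merged into one kernel-verified Lean document; each statement's English description precedes it below -/
import Mathlib

section
/- (Vaughan's identity — Lemma 4.1.) Let U, V, N be positive integers with UV ≤ N, and let f : ℕ → ℂ be any sequence. Then 𝔼_{N<n≤2N} μ(n) conj(f(n)) = -T_I + T_II, where T_I := (1/N) Σ_{1≤d≤UV} a_d Σ_{N/d < w ≤ 2N/d} conj(f(dw)) with a_d := Σ_{bc=d, b≤U, c≤V} μ(b)μ(c), and T_II := (1/N) Σ_{V<d≤2N/U} Σ_{max(U,N/d) < w ≤ 2N/d} μ(w) b_d conj(f(dw)) with b_d := Σ_{c∣d, c>V} μ(c). (Here the averages and sums are over integers in the indicated ranges.) -/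
open Finset

/-- The restriction of the Möbius function to `n ≤ U`. -/
def moebiusLE (U : ℕ) : ArithmeticFunction ℤ where
  toFun n := if n ≤ U then ArithmeticFunction.moebius n else 0
  map_zero' := by simp

/-- The restriction of the Möbius function to `n > U`. -/
def moebiusGT (U : ℕ) : ArithmeticFunction ℤ where
  toFun n := if U < n then ArithmeticFunction.moebius n else 0
  map_zero' := by simp

theorem moebiusLE_apply (U n : ℕ) :
    moebiusLE U n = if n ≤ U then ArithmeticFunction.moebius n else 0 := rfl

theorem moebiusGT_apply (U n : ℕ) :
    moebiusGT U n = if U < n then ArithmeticFunction.moebius n else 0 := rfl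

theorem moebiusGT_eq_sub (U : ℕ) :
    moebiusGT U = ArithmeticFunction.moebius - moebiusLE U := by
  ext n
  rw [sub_eq_add_neg, ArithmeticFunction.add_apply, ArithmeticFunction.neg_apply,
    moebiusGT_apply, moebiusLE_apply]
  split_ifs <;> omega

theorem moebiusLE_mul_moebiusLE_apply (U V d : ℕ) :
    (moebiusLE U * moebiusLE V) d = ∑ p ∈ d.divisorsAntidiagonal,
      if p.1 ≤ U ∧ p.2 ≤ V then
        ArithmeticFunction.moebius p.1 * ArithmeticFunction.moebius p.2 else 0 := by
  rw [ArithmeticFunction.mul_apply]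
  refine sum_congr rfl fun p _ => ?_
  rw [moebiusLE_apply, moebiusLE_apply, ite_and]
  split_ifs <;> simp

theorem moebiusLE_mul_moebiusLE_apply_eq_zero {U V d : ℕ} (h : U * V < d) :
    (moebiusLE U * moebiusLE V) d = 0 := by
  rw [moebiusLE_mul_moebiusLE_apply]
  refine sum_eq_zero fun p hp => if_neg fun hle => ?_
  have := (Nat.mem_divisorsAntidiagonal.mp hp).1
  have := Nat.mul_le_mul hle.1 hle.2
  omega

theorem moebiusGT_mul_zeta_apply (V d : ℕ) :
    (moebiusGT V * (ArithmeticFunction.zeta : ArithmeticFunction ℤ)) d =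
      ∑ c ∈ d.divisors, if V < c then ArithmeticFunction.moebius c else 0 := by
  rw [ArithmeticFunction.coe_mul_zeta_apply]
  rfl

theorem moebiusGT_mul_zeta_apply_eq_zero {V d : ℕ} (h : d ≤ V) :
    (moebiusGT V * (ArithmeticFunction.zeta : ArithmeticFunction ℤ)) d = 0 := by
  rw [moebiusGT_mul_zeta_apply]
  refine sum_eq_zero fun c hc => if_neg ?_
  have := Nat.divisor_le hc
  omega

/-- The pointwise form of Vaughan's identity. -/
theorem moebius_eq_neg_add {U V n : ℕ} (hU : U < n) (hV : V < n) :
    ArithmeticFunction.moebius n =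
      -(moebiusLE U * moebiusLE V * (ArithmeticFunction.zeta : ArithmeticFunction ℤ)) n +
        (moebiusGT V * (ArithmeticFunction.zeta : ArithmeticFunction ℤ) * moebiusGT U) n := by
  have key : moebiusGT V * (ArithmeticFunction.zeta : ArithmeticFunction ℤ) * moebiusGT U +
      moebiusLE U + moebiusLE V = ArithmeticFunction.moebius +
        moebiusLE U * moebiusLE V * (ArithmeticFunction.zeta : ArithmeticFunction ℤ) := by
    rw [moebiusGT_eq_sub, moebiusGT_eq_sub]
    linear_combination (ArithmeticFunction.moebius - moebiusLE U - moebiusLE V) *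
      ArithmeticFunction.moebius_mul_coe_zeta
  have h := congrArg (fun g : ArithmeticFunction ℤ => g n) key
  simp only [ArithmeticFunction.add_apply] at h
  rw [moebiusLE_apply U, moebiusLE_apply V, if_neg (by omega), if_neg (by omega)] at h
  linarith

/-- The hyperbola-type rearrangement of a sum over factorizations `n = d * w`. -/
theorem sum_Ioc_sum_divisorsAntidiagonal {M : Type*} [AddCommMonoid M] (A B : ℕ) (G : ℕ → ℕ → M) :
    ∑ n ∈ Ioc A B, ∑ p ∈ n.divisorsAntidiagonal, G p.1 p.2 =
      ∑ d ∈ Icc 1 B, ∑ w ∈ Ioc (A / d) (B / d), G d w := by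
  rw [sum_sigma', sum_sigma']
  refine sum_bij' (fun x _ => ⟨x.2.1, x.2.2⟩) (fun y _ => ⟨y.1 * y.2, (y.1, y.2)⟩) ?_ ?_ ?_ ?_ ?_
  · rintro ⟨n, d, w⟩ h
    simp only [mem_sigma, mem_Ioc, Nat.mem_divisorsAntidiagonal, mem_Icc] at h ⊢
    obtain ⟨⟨hA, hB⟩, rfl, h0⟩ := h
    have hd : 0 < d := Nat.pos_of_ne_zero (left_ne_zero_of_mul h0)
    have hw : 0 < w := Nat.pos_of_ne_zero (right_ne_zero_of_mul h0)
    refine ⟨⟨hd, (Nat.le_mul_of_pos_right d hw).trans hB⟩, ?_, ?_⟩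
    · rwa [Nat.div_lt_iff_lt_mul hd, mul_comm]
    · rwa [Nat.le_div_iff_mul_le hd, mul_comm]
  · rintro ⟨d, w⟩ h
    simp only [mem_sigma, mem_Ioc, Nat.mem_divisorsAntidiagonal, mem_Icc] at h ⊢
    obtain ⟨⟨hd, -⟩, hA, hB⟩ := h
    rw [Nat.div_lt_iff_lt_mul hd, mul_comm] at hA
    rw [Nat.le_div_iff_mul_le hd, mul_comm] at hB
    exact ⟨⟨hA, hB⟩, trivial, by omega⟩
  · rintro ⟨n, d, w⟩ h
    simp only [mem_sigma, Nat.mem_divisorsAntidiagonal] at h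
    obtain ⟨-, rfl, -⟩ := h
    rfl
  · intros
    rfl
  · intros
    rfl

theorem sum_Ioc_mul_apply {R : Type*} [CommRing R] (A B : ℕ) (g h : ArithmeticFunction ℤ)
    (F : ℕ → R) :
    ∑ n ∈ Ioc A B, ((g * h) n : R) * F n =
      ∑ d ∈ Icc 1 B, ∑ w ∈ Ioc (A / d) (B / d), (g d : R) * (h w : R) * F (d * w) := by
  rw [← sum_Ioc_sum_divisorsAntidiagonal A B fun d w => (g d : R) * (h w : R) * F (d * w)]
  refine sum_congr rfl fun n _ => ?_
  rw [ArithmeticFunction.mul_apply, Int.cast_sum, sum_mul]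
  refine sum_congr rfl fun p hp => ?_
  rw [(Nat.mem_divisorsAntidiagonal.mp hp).1, Int.cast_mul]

theorem sum_Ioc_moebiusLE_mul_moebiusLE_mul_zeta {R : Type*} [CommRing R] {U V A B : ℕ}
    (hUV : U * V ≤ B) (F : ℕ → R) :
    ∑ n ∈ Ioc A B,
        ((moebiusLE U * moebiusLE V * (ArithmeticFunction.zeta : ArithmeticFunction ℤ)) n : R) *
          F n =
      ∑ d ∈ Icc 1 (U * V),
        ((moebiusLE U * moebiusLE V) d : R) * ∑ w ∈ Ioc (A / d) (B / d), F (d * w) := by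
  rw [sum_Ioc_mul_apply]
  symm
  refine sum_subset_zero_on_sdiff (Icc_subset_Icc_right hUV) (fun d hd => ?_) fun d _ => ?_
  · simp only [mem_sdiff, mem_Icc] at hd
    simp [moebiusLE_mul_moebiusLE_apply_eq_zero (show U * V < d by omega)]
  · rw [mul_sum]
    refine sum_congr rfl fun w hw => ?_
    have hw0 : w ≠ 0 := Nat.ne_zero_of_lt (mem_Ioc.mp hw).1
    simp [ArithmeticFunction.natCoe_apply, ArithmeticFunction.zeta_apply_ne hw0]

theorem sum_Ioc_moebiusGT_mul_zeta_mul_moebiusGT {R : Type*} [CommRing R] {U : ℕ} (hU : 0 < U)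
    (V A B : ℕ) (F : ℕ → R) :
    ∑ n ∈ Ioc A B,
        ((moebiusGT V * (ArithmeticFunction.zeta : ArithmeticFunction ℤ) * moebiusGT U) n : R) *
          F n =
      ∑ d ∈ Ioc V (B / U), ∑ w ∈ Ioc (max U (A / d)) (B / d),
        (ArithmeticFunction.moebius w : R) *
          ((moebiusGT V * (ArithmeticFunction.zeta : ArithmeticFunction ℤ)) d : R) *
            F (d * w) := by
  rw [sum_Ioc_mul_apply]
  symm
  refine sum_subset_zero_on_sdiff (fun d hd => ?_) (fun d hd => ?_) fun d _ => ?_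
  · rw [mem_Ioc] at hd
    have := Nat.div_le_self B U
    rw [mem_Icc]
    omega
  · simp only [mem_sdiff, mem_Icc, mem_Ioc] at hd
    refine sum_eq_zero fun w hw => ?_
    rw [mem_Ioc] at hw
    by_cases hV : d ≤ V
    · simp [moebiusGT_mul_zeta_apply_eq_zero hV]
    · have hwU : ¬ U < w := fun h => hd.2 ⟨by omega, by
        rw [Nat.le_div_iff_mul_le hU, mul_comm, ← Nat.le_div_iff_mul_le (by omega)]
        omega⟩
      simp [moebiusGT_apply, hwU]
  · refine sum_subset_zero_on_sdiff (Ioc_subset_Ioc_left (le_max_right _ _)) (fun w hw => ?_)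
      fun w hw => ?_
    · have hwU : ¬ U < w := by
        simp only [mem_sdiff, mem_Ioc] at hw
        omega
      simp [moebiusGT_apply, hwU]
    · have hwU : U < w := (le_max_left _ _).trans_lt (mem_Ioc.mp hw).1
      rw [moebiusGT_apply U, if_pos hwU]
      ring

/-- Vaughan's identity (Lemma 4.1). Let `U, V, N` be positive integers with `UV ≤ N` and let
`f : ℕ → ℂ`. Then `𝔼_{N < n ≤ 2N} μ(n) conj(f(n)) = -T_I + T_II`, where
`T_I = (1/N) ∑_{1 ≤ d ≤ UV} a_d ∑_{N/d < w ≤ 2N/d} conj(f(dw))` with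
`a_d = ∑_{bc = d, b ≤ U, c ≤ V} μ(b)μ(c)`, and
`T_II = (1/N) ∑_{V < d ≤ 2N/U} ∑_{max(U, N/d) < w ≤ 2N/d} μ(w) b_d conj(f(dw))` with
`b_d = ∑_{c ∣ d, c > V} μ(c)`.  (Ranges are over integers; `w > N/d` means `dw > N`, etc.) -/
theorem vaughan_identity (U V N : ℕ) (hU : 0 < U) (hV : 0 < V) (hN : 0 < N)
    (hUV : U * V ≤ N) (f : ℕ → ℂ) :
    (N : ℂ)⁻¹ * ∑ n ∈ Finset.Ioc N (2 * N),
        (ArithmeticFunction.moebius n : ℂ) * (starRingEnd ℂ) (f n) =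
      -((N : ℂ)⁻¹ * ∑ d ∈ Finset.Icc 1 (U * V),
          ((∑ p ∈ Nat.divisorsAntidiagonal d,
              if p.1 ≤ U ∧ p.2 ≤ V then
                ArithmeticFunction.moebius p.1 * ArithmeticFunction.moebius p.2
              else 0 : ℤ) : ℂ) *
            ∑ w ∈ Finset.Ioc (N / d) (2 * N / d), (starRingEnd ℂ) (f (d * w)))
      + (N : ℂ)⁻¹ * ∑ d ∈ Finset.Ioc V (2 * N / U),
          ∑ w ∈ Finset.Ioc (max U (N / d)) (2 * N / d),
            (ArithmeticFunction.moebius w : ℂ) *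
              ((∑ c ∈ Nat.divisors d, if V < c then ArithmeticFunction.moebius c else 0 : ℤ) : ℂ) *
                (starRingEnd ℂ) (f (d * w)) := by
  have hUN : U ≤ N := (Nat.le_mul_of_pos_right U hV).trans hUV
  have hVN : V ≤ N := (Nat.le_mul_of_pos_left V hU).trans hUV
  simp only [← moebiusLE_mul_moebiusLE_apply, ← moebiusGT_mul_zeta_apply]
  rw [← sum_Ioc_moebiusLE_mul_moebiusLE_mul_zeta (by omega) fun n => (starRingEnd ℂ) (f n),
    ← sum_Ioc_moebiusGT_mul_zeta_mul_moebiusGT hU V N (2 * N) fun n => (starRingEnd ℂ) (f n),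
    ← mul_neg, ← mul_add, ← sum_neg_distrib, ← sum_add_distrib]
  congr 1
  refine sum_congr rfl fun n hn => ?_
  have hNn := (mem_Ioc.mp hn).1
  rw [moebius_eq_neg_add (hUN.trans_lt hNn) (hVN.trans_lt hNn)]
  push_cast
  ring
end

section
/- (Recurrent linear functions are major arc — Lemma A.4.) Let I ⊆ ℤ be a nonempty discrete interval, let α ∈ ℝ, and let 0 < δ₁, δ₂ < 1 with δ₁ ≤ δ₂/4. Suppose the set 𝔏 := {l ∈ I : ‖αl‖_{ℝ/ℤ} ≤ δ₁} has cardinality at least δ₂|I|. Then: (i) if |I| > 1/δ₂, there exists an integer q with 1 ≤ q ≤ 8/δ₂ and ‖qα‖_{ℝ/ℤ} ≤ 2⁸/(δ₂² |I|); (ii) if |I| > 2/δ₂², there exists an integer q with 1 ≤ q ≤ 16/δ₂² and ‖qα‖_{ℝ/ℤ} ≤ 2¹⁵ δ₁/(δ₂⁶ |I|). -/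
open Finset

/-- `‖x‖_{ℝ/ℤ}` is the distance from `x` to the nearest integer. -/
noncomputable def distToInt (x : ℝ) : ℝ := |x - round x|

/-- The nearest integer is at least as close as any other integer. -/
lemma distToInt_le_abs_sub (x : ℝ) (m : ℤ) : distToInt x ≤ |x - m| := round_le x m

/-- A finite set of integers of diameter at most `R` lying in one residue class modulo `q` has
at most `⌊R / q⌋ + 1` elements. -/
lemma card_le_floor_div_add_one (S : Finset ℤ) (q : ℕ) (hq : 0 < q) (R : ℝ)
    (hmod : ∀ x ∈ S, ∀ y ∈ S, (q : ℤ) ∣ x - y)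
    (hR : ∀ x ∈ S, ∀ y ∈ S, ((x - y : ℤ) : ℝ) ≤ R) :
    S.card ≤ ⌊R / q⌋₊ + 1 := by
  rcases S.eq_empty_or_nonempty with rfl | hne
  · simp
  have hq' : (0 : ℝ) < q := by exact_mod_cast hq
  have hx₀ := S.min'_mem hne
  set x₀ := S.min' hne
  have hmaps : ∀ x ∈ S, ((x - x₀) / q).toNat ∈ Finset.range (⌊R / q⌋₊ + 1) := by
    intro x hx
    rw [Finset.mem_range, Nat.lt_succ_iff]
    obtain ⟨c, hc⟩ := hmod x hx x₀ hx₀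
    have hle := S.min'_le x hx
    have hRx := hR x hx x₀ hx₀
    have hc0 : 0 ≤ c := by
      have : 0 ≤ (q : ℤ) * c := by rw [← hc]; exact sub_nonneg.2 hle
      exact nonneg_of_mul_nonneg_right this (by exact_mod_cast hq)
    rw [hc, Int.mul_ediv_cancel_left _ (by exact_mod_cast hq.ne')]
    apply Nat.le_floor
    have hcast : ((c.toNat : ℕ) : ℝ) = (c : ℝ) := by exact_mod_cast Int.toNat_of_nonneg hc0
    rw [hcast, le_div_iff₀ hq']
    rw [hc] at hRx
    push_cast at hRx
    linarith
  have hinj : Set.InjOn (fun x : ℤ => ((x - x₀) / q).toNat) S := by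
    intro x hx y hy hxy
    obtain ⟨c, hc⟩ := hmod x hx x₀ hx₀
    obtain ⟨d, hd⟩ := hmod y hy x₀ hx₀
    have hlex := S.min'_le x hx
    have hley := S.min'_le y hy
    have hxy' : ((x - x₀) / q) = ((y - x₀) / q) := by
      have h1 : 0 ≤ (x - x₀) / (q : ℤ) := Int.ediv_nonneg (sub_nonneg.2 hlex) (by positivity)
      have h2 : 0 ≤ (y - x₀) / (q : ℤ) := Int.ediv_nonneg (sub_nonneg.2 hley) (by positivity)
      dsimp only at hxy
      omega
    rw [hc, hd, Int.mul_ediv_cancel_left _ (by exact_mod_cast hq.ne'),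
      Int.mul_ediv_cancel_left _ (by exact_mod_cast hq.ne')] at hxy'
    rw [hxy'] at hc
    linarith
  simpa using Finset.card_le_card_of_injOn _ hmaps hinj

/-- If every subset of `S ⊆ [a, b]` of diameter less than `k` has at most `c` elements, then
`S` has at most `c (|[a, b]| / k + 1)` elements. -/
lemma card_le_mul_of_short_subsets (a b : ℤ) (S : Finset ℤ) (hS : S ⊆ Finset.Icc a b) (k c : ℕ)
    (hk : 0 < k)
    (hc : ∀ U ⊆ S, (∀ x ∈ U, ∀ y ∈ U, x - y < (k : ℤ)) → U.card ≤ c) :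
    (S.card : ℝ) ≤ c * ((Finset.Icc a b).card / k + 1) := by
  have hk' : (0 : ℤ) < k := by exact_mod_cast hk
  have himage : ((S.image fun l => (l - a) / (k : ℤ)).card : ℝ) ≤
      (Finset.Icc a b).card / k + 1 := by
    have hcount := card_le_floor_div_add_one (S.image fun l => (l - a) / (k : ℤ)) 1 one_pos
      ((Finset.Icc a b).card / k : ℝ) (by simp) (by
        intro u hu v hv
        obtain ⟨x, hx, rfl⟩ := Finset.mem_image.1 hu
        obtain ⟨y, hy, rfl⟩ := Finset.mem_image.1 hv
        have hx' := Finset.mem_Icc.1 (hS hx)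
        have hy' := Finset.mem_Icc.1 (hS hy)
        have h0 : 0 ≤ (y - a) / (k : ℤ) := Int.ediv_nonneg (by linarith) hk'.le
        have h1 : (x - a) / (k : ℤ) * k ≤ x - a := Int.ediv_mul_le _ hk'.ne'
        have h2 : ((Finset.Icc a b).card : ℤ) = b + 1 - a := by
          rw [Int.card_Icc]
          omega
        have h3 : ((x - a) / (k : ℤ) - (y - a) / (k : ℤ)) * k ≤ (Finset.Icc a b).card := by
          nlinarith
        rw [le_div_iff₀ (by exact_mod_cast hk)]
        exact_mod_cast h3)
    have hfloor : (⌊((Finset.Icc a b).card / k : ℝ) / (1 : ℕ)⌋₊ : ℝ) ≤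
        (Finset.Icc a b).card / k := by
      simpa using Nat.floor_le (by positivity : (0 : ℝ) ≤ (Finset.Icc a b).card / k)
    have hcast : ((S.image fun l => (l - a) / (k : ℤ)).card : ℝ) ≤
        (⌊((Finset.Icc a b).card / k : ℝ) / (1 : ℕ)⌋₊ : ℝ) + 1 := by exact_mod_cast hcount
    linarith
  have hfiber := Finset.card_le_mul_card_image (f := fun l => (l - a) / (k : ℤ)) S c (by
    intro u _
    apply hc _ (Finset.filter_subset _ _)
    intro x hx y hy
    have hx' := (Finset.mem_filter.1 hx).2
    have hy' := (Finset.mem_filter.1 hy).2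
    have h1 := Int.emod_add_mul_ediv (x - a) k
    have h2 := Int.emod_add_mul_ediv (y - a) k
    have h3 := Int.emod_lt_of_pos (x - a) hk'
    have h4 := Int.emod_nonneg (y - a) hk'.ne'
    rw [hx'] at h1
    rw [hy'] at h2
    linarith)
  calc (S.card : ℝ) ≤ c * ((S.image fun l => (l - a) / (k : ℤ)).card : ℝ) := by
        exact_mod_cast hfiber
    _ ≤ _ := by gcongr

/-- Let `r` be a rational with denominator `q`, and put `θ = q α - q r`. If `S` has diameter at
most `T`, consists of `l` with `α l` within `δ` of an integer, and any two of its elements at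
distance `d` with `d |θ| ≤ 2 q δ` satisfy `d ≤ D`, then `S` has at most
`(⌊D / q⌋ + 1) (|θ| T + 2 q δ + 1)` elements. -/
lemma card_le_of_distToInt_le (α δ T D : ℝ) (r : ℚ) (S : Finset ℤ) (hδ : 0 ≤ δ) (hT : 0 ≤ T)
    (hS : ∀ l ∈ S, distToInt (α * l) ≤ δ)
    (hST : ∀ x ∈ S, ∀ y ∈ S, ((x - y : ℤ) : ℝ) ≤ T)
    (hSD : ∀ x ∈ S, ∀ y ∈ S, |r.den * α - r.num| * ((x - y : ℤ) : ℝ) ≤ 2 * r.den * δ →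
      ((x - y : ℤ) : ℝ) ≤ D) :
    (S.card : ℝ) ≤ ((⌊D / r.den⌋₊ + 1 : ℕ) : ℝ) *
      (|r.den * α - r.num| * T + 2 * r.den * δ + 1) := by
  set q := r.den
  set p := r.num
  set θ : ℝ := q * α - p
  set f : ℤ → ℤ := fun l => q * round (α * l) - p * l
  have hnear : ∀ l ∈ S, |(f l : ℝ) - l * θ| ≤ q * δ := by
    intro l hl
    have h : (f l : ℝ) - l * θ = -(q * (α * l - round (α * l))) := by
      simp only [f, θ]
      push_cast
      ring
    rw [h, abs_neg, abs_mul, Nat.abs_cast]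
    exact mul_le_mul_of_nonneg_left (hS l hl) (by positivity)
  have himage : ((S.image f).card : ℝ) ≤ |θ| * T + 2 * q * δ + 1 := by
    have hcount := card_le_floor_div_add_one (S.image f) 1 one_pos (|θ| * T + 2 * q * δ)
      (by simp) (by
        intro u hu v hv
        obtain ⟨x, hx, rfl⟩ := Finset.mem_image.1 hu
        obtain ⟨y, hy, rfl⟩ := Finset.mem_image.1 hv
        have h1 := abs_le.1 (hnear x hx)
        have h2 := abs_le.1 (hnear y hy)
        have h3 : |((x - y : ℤ) : ℝ)| ≤ T := by
          rw [abs_le]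
          have := hST y hy x hx
          have := hST x hx y hy
          push_cast at *
          constructor <;> linarith
        have h4 : ((x - y : ℤ) : ℝ) * θ ≤ |θ| * T := by
          calc ((x - y : ℤ) : ℝ) * θ ≤ |((x - y : ℤ) : ℝ) * θ| := le_abs_self _
            _ = |θ| * |((x - y : ℤ) : ℝ)| := by rw [abs_mul, mul_comm]
            _ ≤ _ := by gcongr
        push_cast at *
        linarith [h1.2, h2.1])
    have hfloor : (⌊(|θ| * T + 2 * q * δ) / (1 : ℕ)⌋₊ : ℝ) ≤ |θ| * T + 2 * q * δ := by
      simpa using Nat.floor_le (by positivity : 0 ≤ |θ| * T + 2 * q * δ)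
    have hcast : ((S.image f).card : ℝ) ≤ (⌊(|θ| * T + 2 * q * δ) / (1 : ℕ)⌋₊ : ℝ) + 1 := by
      exact_mod_cast hcount
    linarith
  have hfiber := Finset.card_le_mul_card_image (f := f) S (⌊D / q⌋₊ + 1) (by
    intro m _
    apply card_le_floor_div_add_one _ q r.den_pos
    · intro x hx y hy
      have hxy : f x = f y := (Finset.mem_filter.1 hx).2.trans (Finset.mem_filter.1 hy).2.symm
      have hcop : IsCoprime (q : ℤ) p := by
        rw [Int.isCoprime_iff_gcd_eq_one, Int.gcd_comm]
        exact r.reduced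
      apply hcop.dvd_of_dvd_mul_left
      refine ⟨round (α * x) - round (α * y), ?_⟩
      simp only [f] at hxy
      linarith
    · intro x hx y hy
      have hx' := Finset.mem_filter.1 hx
      have hy' := Finset.mem_filter.1 hy
      have h1 := abs_le.1 (hnear x hx'.1)
      have h2 := abs_le.1 (hnear y hy'.1)
      rw [hx'.2] at h1
      rw [hy'.2] at h2
      have hclose : |θ| * |((x - y : ℤ) : ℝ)| ≤ 2 * q * δ := by
        rw [← abs_mul, abs_le]
        push_cast
        constructor <;> linarith [h1.1, h1.2, h2.1, h2.2]
      refine hSD x hx'.1 y hy'.1 (le_trans ?_ hclose)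
      gcongr
      exact le_abs_self _)
  calc (S.card : ℝ) ≤ ((⌊D / q⌋₊ + 1 : ℕ) : ℝ) * ((S.image f).card : ℝ) := by
        exact_mod_cast hfiber
    _ ≤ _ := by gcongr

/-- If `α l` is close to an integer for many `l` in a long interval, then `α` is close to a
rational of small denominator. -/
lemma exists_rat_of_recurrent (a b : ℤ) (α δ₁ δ₂ : ℝ)
    (hδ₁0 : 0 < δ₁) (hδ₂0 : 0 < δ₂) (hδ₂1 : δ₂ < 1) (hδ : δ₁ ≤ δ₂ / 4)
    (hcard : δ₂ * ((Finset.Icc a b).card : ℝ) ≤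
      (((Finset.Icc a b).filter (fun l : ℤ => distToInt (α * l) ≤ δ₁)).card : ℝ))
    (hN : 2 ^ 9 < δ₂ ^ 2 * ((Finset.Icc a b).card : ℝ)) :
    ∃ r : ℚ, (r.den : ℝ) ≤ 8 / δ₂ ∧
      |r.den * α - r.num| ≤ 2 ^ 8 / (δ₂ ^ 2 * ((Finset.Icc a b).card : ℝ)) := by
  set N : ℝ := ((Finset.Icc a b).card : ℝ)
  set n := ⌊δ₂ ^ 2 * N / 2 ^ 8⌋₊
  have hn : 0 < n := Nat.floor_pos.2 (by linarith)
  have hn_le : (n : ℝ) ≤ δ₂ ^ 2 * N / 2 ^ 8 := Nat.floor_le (by linarith)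
  have hlt_n : δ₂ ^ 2 * N / 2 ^ 8 < n + 1 := Nat.lt_floor_add_one _
  obtain ⟨r, hr, hrn⟩ := Real.exists_rat_abs_sub_le_and_den_le α hn
  have hq0 : (0 : ℝ) < r.den := by exact_mod_cast r.den_pos
  have hqn : (r.den : ℝ) ≤ n := by exact_mod_cast hrn
  have hθ : |r.den * α - r.num| ≤ 1 / (n + 1) := by
    have hfactor : (r.den : ℝ) * α - r.num = r.den * (α - r) := by
      rw [Rat.cast_def]
      field_simp
    rw [hfactor, abs_mul, Nat.abs_cast]
    calc (r.den : ℝ) * |α - r| ≤ r.den * (1 / ((n + 1) * r.den)) := by gcongr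
      _ = 1 / (n + 1) := by field_simp
  refine ⟨r, ?_, hθ.trans ?_⟩
  · by_contra! hq
    have hcount := card_le_mul_of_short_subsets a b _ (Finset.filter_subset
      (fun l : ℤ => distToInt (α * l) ≤ δ₁) (Finset.Icc a b)) r.den
      ⌊2 * r.den * δ₁ + 2⌋₊ r.den_pos (by
        intro U hU hUd
        have hUd' : ∀ x ∈ U, ∀ y ∈ U, ((x - y : ℤ) : ℝ) ≤ r.den - 1 := by
          intro x hx y hy
          have h : x - y ≤ (r.den : ℤ) - 1 := by linarith [Int.add_one_le_of_lt (hUd x hx y hy)]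
          exact_mod_cast h
        have hone : (1 : ℝ) ≤ r.den := by exact_mod_cast r.den_pos
        have h := card_le_of_distToInt_le α δ₁ (r.den - 1) (r.den - 1) r U hδ₁0.le
          (by linarith) (fun l hl => (Finset.mem_filter.1 (hU hl)).2) hUd'
          (fun x hx y hy _ => hUd' x hx y hy)
        have hfloor : ⌊((r.den : ℝ) - 1) / r.den⌋₊ = 0 := by
          rw [Nat.floor_eq_zero, div_lt_one hq0]
          linarith
        rw [hfloor] at h
        apply Nat.le_floor
        have hsmall : |r.den * α - r.num| * ((r.den : ℝ) - 1) ≤ 1 := by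
          calc |r.den * α - r.num| * ((r.den : ℝ) - 1) ≤ 1 / (n + 1) * (n + 1) := by
                gcongr
                linarith
            _ = 1 := by field_simp
        push_cast at h
        linarith)
    have hfloor : (⌊2 * r.den * δ₁ + 2⌋₊ : ℝ) ≤ 2 * r.den * δ₁ + 2 :=
      Nat.floor_le (by positivity)
    have hN0 : 0 ≤ N := by positivity
    have hbound : δ₂ * N ≤ (2 * r.den * δ₁ + 2) * (N / r.den + 1) :=
      hcard.trans (hcount.trans (by gcongr))
    have hexpand : (2 * r.den * δ₁ + 2) * (N / r.den + 1) =
        2 * δ₁ * N + 2 * r.den * δ₁ + 2 * (N / r.den) + 2 := by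
      field_simp
      ring
    have h1 : N / r.den ≤ N * δ₂ / 8 := by
      rw [div_lt_iff₀ hδ₂0] at hq
      rw [div_le_iff₀ hq0]
      nlinarith
    have h2 : δ₁ * N ≤ δ₂ / 4 * N := by gcongr
    have h3 : r.den * δ₁ ≤ r.den * (1 / 4) := by gcongr; linarith
    have h4 : δ₂ ^ 2 * N ≤ δ₂ * N := by
      gcongr
      nlinarith
    linarith
  · rw [div_le_div_iff₀ (by positivity) (by linarith)]
    linarith

/-- Recurrent linear functions are major arc (Lemma A.4). Let `I = [a, b] ⊆ ℤ` be a nonempty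
discrete interval, `α ∈ ℝ`, and `0 < δ₁, δ₂ < 1` with `δ₁ ≤ δ₂/4`.  Suppose
`#{l ∈ I : ‖αl‖_{ℝ/ℤ} ≤ δ₁} ≥ δ₂ |I|`.  Then:
(i) if `|I| > 1/δ₂`, there is an integer `1 ≤ q ≤ 8/δ₂` with `‖qα‖_{ℝ/ℤ} ≤ 2⁸/(δ₂²|I|)`;
(ii) if `|I| > 2/δ₂²`, there is an integer `1 ≤ q ≤ 16/δ₂²` with `‖qα‖_{ℝ/ℤ} ≤ 2¹⁵δ₁/(δ₂⁶|I|)`. -/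
theorem recurrent_linear_major_arc (a b : ℤ) (hab : a ≤ b) (α : ℝ) (δ₁ δ₂ : ℝ)
    (hδ₁0 : 0 < δ₁) (hδ₁1 : δ₁ < 1) (hδ₂0 : 0 < δ₂) (hδ₂1 : δ₂ < 1) (hδ : δ₁ ≤ δ₂ / 4)
    (hcard : δ₂ * ((Finset.Icc a b).card : ℝ) ≤
      (((Finset.Icc a b).filter (fun l : ℤ => distToInt (α * l) ≤ δ₁)).card : ℝ)) :
    ((1 / δ₂ < ((Finset.Icc a b).card : ℝ)) →
        ∃ q : ℕ, 1 ≤ q ∧ (q : ℝ) ≤ 8 / δ₂ ∧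
          distToInt (q * α) ≤ 2 ^ 8 / (δ₂ ^ 2 * ((Finset.Icc a b).card : ℝ)))
    ∧ ((2 / δ₂ ^ 2 < ((Finset.Icc a b).card : ℝ)) →
        ∃ q : ℕ, 1 ≤ q ∧ (q : ℝ) ≤ 16 / δ₂ ^ 2 ∧
          distToInt (q * α) ≤ 2 ^ 15 * δ₁ / (δ₂ ^ 6 * ((Finset.Icc a b).card : ℝ))) := by
  set N : ℝ := ((Finset.Icc a b).card : ℝ)
  have hN1 : 1 ≤ N :=
    Nat.one_le_cast.2 (Finset.card_pos.2 (Finset.nonempty_Icc.2 hab))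
  have hrat := exists_rat_of_recurrent a b α δ₁ δ₂ hδ₁0 hδ₂0 hδ₂1 hδ hcard
  constructor
  · intro _
    rcases le_or_gt (δ₂ ^ 2 * N) (2 ^ 9) with hN | hN
    · refine ⟨1, le_rfl, ?_, (abs_sub_round _).trans ?_⟩
      · rw [le_div_iff₀ hδ₂0]
        push_cast
        linarith
      · rw [div_le_div_iff₀ two_pos (by positivity)]
        linarith
    · obtain ⟨r, hr, hθ⟩ := hrat hN
      exact ⟨r.den, r.den_pos, hr, (distToInt_le_abs_sub _ _).trans hθ⟩
  intro hN2
  rw [div_lt_iff₀ (by positivity)] at hN2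
  have hδ₂sq : δ₂ ^ 2 ≤ δ₂ := by nlinarith
  have hδ₂sq1 : δ₂ ^ 2 ≤ 1 := by linarith
  rcases le_or_gt (δ₂ ^ 6 * N) (2 ^ 14) with hN | hN
  · set k := ⌊16 / δ₂ ^ 2⌋₊
    have hk_le : (k : ℝ) ≤ 16 / δ₂ ^ 2 := Nat.floor_le (by positivity)
    have hlt_k : 16 / δ₂ ^ 2 < k + 1 := Nat.lt_floor_add_one _
    rw [div_lt_iff₀ (by positivity)] at hlt_k
    have hk0 : (0 : ℝ) < k := by
      by_contra! h
      nlinarith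
    by_contra! hno
    have hcount := card_le_mul_of_short_subsets a b _ (Finset.filter_subset
      (fun l : ℤ => distToInt (α * l) ≤ δ₁) (Finset.Icc a b)) k 1 (by exact_mod_cast hk0) (by
        intro U hU hUd
        rw [Finset.card_le_one]
        have hle : ∀ x ∈ U, ∀ y ∈ U, x ≤ y := by
          intro x hx y hy
          by_contra! hyx
          have hcast : (((x - y).toNat : ℕ) : ℝ) = x - y := by
            exact_mod_cast Int.toNat_of_nonneg (sub_nonneg.2 hyx.le)
          have hdk : (x - y : ℝ) ≤ k := by exact_mod_cast (hUd x hx y hy).le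
          have hfar := hno (x - y).toNat (by omega) (by rw [hcast]; linarith)
          have hx' : |α * x - round (α * x)| ≤ δ₁ := (Finset.mem_filter.1 (hU hx)).2
          have hy' : |α * y - round (α * y)| ≤ δ₁ := (Finset.mem_filter.1 (hU hy)).2
          have hclose : distToInt (((x - y).toNat : ℕ) * α) ≤ 2 * δ₁ := by
            refine (distToInt_le_abs_sub _ (round (α * x) - round (α * y))).trans ?_
            rw [hcast]
            push_cast
            rw [abs_le] at *
            constructor <;> linarith [hx'.1, hx'.2, hy'.1, hy'.2]
          have h : 2 * δ₁ ≤ 2 ^ 15 * δ₁ / (δ₂ ^ 6 * N) := by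
            rw [le_div_iff₀ (by positivity)]
            nlinarith
          linarith
        exact fun x hx y hy => le_antisymm (hle x hx y hy) (hle y hy x hx))
    have h1 : N / k ≤ δ₂ ^ 2 * N / 8 := by
      rw [div_le_iff₀ hk0]
      nlinarith
    have h2 : δ₂ ^ 2 * N ≤ δ₂ * N := by gcongr
    push_cast at hcount
    linarith
  · have h64 : δ₂ ^ 6 ≤ δ₂ ^ 3 := pow_le_pow_of_le_one hδ₂0.le hδ₂1.le (by norm_num)
    have h32 : δ₂ ^ 3 ≤ δ₂ ^ 2 := pow_le_pow_of_le_one hδ₂0.le hδ₂1.le (by norm_num)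
    have hN6 : δ₂ ^ 6 * N ≤ δ₂ ^ 3 * N := by gcongr
    have hN3 : δ₂ ^ 3 * N ≤ δ₂ ^ 2 * N := by gcongr
    have hN2' : δ₂ ^ 2 * N ≤ δ₂ * N := by gcongr
    obtain ⟨r, hr, hθ⟩ := hrat (by linarith)
    refine ⟨r.den, r.den_pos, hr.trans ?_, (distToInt_le_abs_sub _ r.num).trans ?_⟩
    · rw [div_le_div_iff₀ hδ₂0 (by positivity)]
      linarith
    by_contra! hlarge
    set η := |r.den * α - r.num|
    have hq0 : (0 : ℝ) < r.den := by exact_mod_cast r.den_pos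
    have hη0 : 0 < η := lt_trans (by positivity) hlarge
    have hcount := card_le_of_distToInt_le α δ₁ N (2 * r.den * δ₁ / η) r
      ((Finset.Icc a b).filter (fun l : ℤ => distToInt (α * l) ≤ δ₁)) hδ₁0.le (by linarith)
      (fun l hl => (Finset.mem_filter.1 hl).2) (by
        intro x hx y hy
        have hx' := Finset.mem_Icc.1 (Finset.mem_filter.1 hx).1
        have hy' := Finset.mem_Icc.1 (Finset.mem_filter.1 hy).1
        have h : x - y ≤ (Finset.Icc a b).card := by
          rw [Int.card_Icc]
          omega
        calc ((x - y : ℤ) : ℝ) ≤ (((Finset.Icc a b).card : ℤ) : ℝ) := Int.cast_le.2 h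
          _ = N := Int.cast_natCast _) (by
        intro x _ y _ h
        rw [le_div_iff₀ hη0]
        linarith)
    have hfloor : ((⌊2 * r.den * δ₁ / η / r.den⌋₊ + 1 : ℕ) : ℝ) ≤ 2 * (δ₁ / η) + 1 := by
      have h : 2 * r.den * δ₁ / η / r.den = 2 * (δ₁ / η) := by field_simp
      have h' := Nat.floor_le (by positivity : 0 ≤ 2 * (δ₁ / η))
      rw [h]
      push_cast
      linarith
    have hbound : δ₂ * N ≤ (2 * (δ₁ / η) + 1) * (η * N + 2 * r.den * δ₁ + 1) :=
      hcard.trans (hcount.trans (by gcongr))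
    have hexpand : (2 * (δ₁ / η) + 1) * (η * N + 2 * r.den * δ₁ + 1) =
        2 * (δ₁ * N) + η * N + 4 * (r.den * δ₁) * (δ₁ / η) + 2 * (r.den * δ₁) +
          2 * (δ₁ / η) + 1 := by
      field_simp
      ring
    have hqδ : r.den * δ₁ ≤ 2 := by
      rw [le_div_iff₀ hδ₂0] at hr
      nlinarith
    have hδη : δ₁ / η ≤ δ₂ ^ 6 * N / 2 ^ 15 := by
      rw [div_lt_iff₀ (by positivity)] at hlarge
      rw [div_le_div_iff₀ hη0 (by norm_num)]
      linarith
    have hprod : 4 * (r.den * δ₁) * (δ₁ / η) ≤ 4 * 2 * (δ₁ / η) := by gcongr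
    have hηN : η * N ≤ δ₂ * N / 64 := by
      have h1 : η * N ≤ 2 ^ 8 / δ₂ ^ 2 := by
        rw [le_div_iff₀ (by positivity)] at hθ ⊢
        linarith
      have h2 : (2 : ℝ) ^ 8 / δ₂ ^ 2 ≤ δ₂ * N / 64 := by
        rw [div_le_div_iff₀ (by positivity) (by norm_num)]
        have h3 : δ₂ ^ 3 * N = δ₂ * N * δ₂ ^ 2 := by ring
        linarith
      linarith
    have hδN : δ₁ * N ≤ δ₂ / 4 * N := by gcongr
    linarith
end

section
/- (Divisor packing lemma — Lemma C.2.) For every κ with 0 < κ < 1/2 there exists a constant c_κ > 0 such that the following holds. Let N ≥ 2, let A ⊆ [N] be nonempty with |A| = αN, and for each integer d ≥ 1 let A_d := {n ∈ A : d ∣ n}. Let 𝔇 be a finite set of positive integers such that |A_d| ≥ δ|A| for all d ∈ 𝔇 and some δ > 0. Then |⋃_{d∈𝔇} A_d| ≥ c_κ δ² |𝔇|² |A| α^κ (log N)^{-2^{2/κ}}. -/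
open Finset

theorem Nat.card_divisors_mul_le (a b : ℕ) :
    (a * b).divisors.card ≤ a.divisors.card * b.divisors.card := by
  open scoped Pointwise in
  rw [Nat.divisors_mul]
  exact Finset.card_mul_le

theorem sum_card_divisors_mul_le_sq (N : ℕ) (f : ℕ → ℝ) (hf0 : ∀ a, 0 ≤ f a)
    (hmul : ∀ a b, f (a * b) ≤ f a * f b) :
    ∑ n ∈ Finset.Icc 1 N, (n.divisors.card : ℝ) * f n ≤ (∑ n ∈ Finset.Icc 1 N, f n) ^ 2 := by
  have hfiber (n : ℕ) (hn : n ∈ Finset.Icc 1 N) :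
      (Finset.Icc 1 N ×ˢ Finset.Icc 1 N).filter (fun x => x.1 * x.2 = n) =
        n.divisorsAntidiagonal := by
    obtain ⟨h1, h2⟩ := Finset.mem_Icc.1 hn
    ext ⟨a, b⟩
    simp only [Finset.mem_filter, Finset.mem_product, Finset.mem_Icc,
      Nat.mem_divisorsAntidiagonal]
    refine ⟨fun h => ⟨h.2, by omega⟩, fun h => ⟨?_, h.1⟩⟩
    have hab : 0 < a * b := by rw [h.1]; exact h1
    have ha : 0 < a := Nat.pos_of_mul_pos_right hab
    have hb : 0 < b := Nat.pos_of_mul_pos_left hab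
    have := Nat.le_mul_of_pos_right a hb
    have := Nat.le_mul_of_pos_left b ha
    omega
  calc ∑ n ∈ Finset.Icc 1 N, (n.divisors.card : ℝ) * f n
      = ∑ n ∈ Finset.Icc 1 N,
          ∑ x ∈ Finset.Icc 1 N ×ˢ Finset.Icc 1 N with x.1 * x.2 = n, f (x.1 * x.2) := by
        refine Finset.sum_congr rfl fun n hn => ?_
        rw [hfiber n hn, Finset.sum_congr rfl (g := fun _ => f n), Finset.sum_const,
          ← Nat.map_div_right_divisors, Finset.card_map, nsmul_eq_mul]
        intro x hx
        rw [(Nat.mem_divisorsAntidiagonal.1 hx).1]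
    _ ≤ ∑ x ∈ Finset.Icc 1 N ×ˢ Finset.Icc 1 N, f (x.1 * x.2) :=
        Finset.sum_fiberwise_le_sum_of_sum_fiber_nonneg
          fun _ _ => Finset.sum_nonneg fun x _ => hf0 _
    _ ≤ ∑ x ∈ Finset.Icc 1 N ×ˢ Finset.Icc 1 N, f x.1 * f x.2 :=
        Finset.sum_le_sum fun x _ => hmul _ _
    _ = (∑ n ∈ Finset.Icc 1 N, f n) ^ 2 := by
        rw [Finset.sum_product, sq, Finset.sum_mul_sum]

theorem sum_card_divisors_pow_div_le (N k : ℕ) :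
    ∑ n ∈ Finset.Icc 1 N, (n.divisors.card : ℝ) ^ k / n ≤ (1 + Real.log N) ^ (2 ^ k) := by
  induction k with
  | zero =>
    have h := harmonic_le_one_add_log N
    rw [harmonic_eq_sum_Icc] at h
    push_cast at h
    simpa using h
  | succ k ih =>
    calc ∑ n ∈ Finset.Icc 1 N, (n.divisors.card : ℝ) ^ (k + 1) / n
        = ∑ n ∈ Finset.Icc 1 N, (n.divisors.card : ℝ) * ((n.divisors.card : ℝ) ^ k / n) :=
          Finset.sum_congr rfl fun n _ => by rw [pow_succ']; ring
      _ ≤ (∑ n ∈ Finset.Icc 1 N, (n.divisors.card : ℝ) ^ k / n) ^ 2 := by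
          refine sum_card_divisors_mul_le_sq N (fun n => (n.divisors.card : ℝ) ^ k / n)
            (fun a => by positivity) fun a b => ?_
          rw [div_mul_div_comm, ← mul_pow, ← Nat.cast_mul a b]
          gcongr
          exact_mod_cast Nat.card_divisors_mul_le a b
      _ ≤ ((1 + Real.log N) ^ (2 ^ k)) ^ 2 := by
          refine pow_le_pow_left₀ (Finset.sum_nonneg fun n _ => by positivity) ih 2
      _ = (1 + Real.log N) ^ (2 ^ (k + 1)) := by rw [← pow_mul, ← pow_succ]

theorem sum_card_divisors_pow_le (N k : ℕ) :
    ∑ n ∈ Finset.Icc 1 N, (n.divisors.card : ℝ) ^ k ≤ N * (1 + Real.log N) ^ (2 ^ k) := by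
  refine le_trans ?_ (mul_le_mul_of_nonneg_left (sum_card_divisors_pow_div_le N k)
    N.cast_nonneg)
  rw [Finset.mul_sum]
  refine Finset.sum_le_sum fun n hn => ?_
  obtain ⟨h1, h2⟩ := Finset.mem_Icc.1 hn
  have hn0 : (0 : ℝ) < n := by exact_mod_cast h1
  rw [mul_div_assoc', le_div_iff₀ hn0, mul_comm]
  gcongr

/-- Second moment of the divisor function on a set of density `α`, via the `k`-th moment. -/
theorem sum_card_divisors_sq_le {N k : ℕ} (hN : 1 ≤ N) (hk : 2 ≤ k) {A : Finset ℕ}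
    (hA : A ⊆ Finset.Icc 1 N) {α : ℝ} (hα : 0 < α) (hAα : (A.card : ℝ) = α * N) :
    ∑ n ∈ A, (n.divisors.card : ℝ) ^ 2 ≤
      A.card * α ^ (-(2 / k : ℝ)) * (1 + Real.log N) ^ ((2 : ℝ) ^ k * (2 / k)) := by
  have hk0 : (0 : ℝ) < k := by exact_mod_cast (by omega : 0 < k)
  have hk2 : (2 : ℝ) ≤ k := by exact_mod_cast hk
  have hL : 0 ≤ Real.log N := Real.log_natCast_nonneg N
  have hN0 : (0 : ℝ) < N := by exact_mod_cast hN
  have hA0 : (0 : ℝ) < A.card := by rw [hAα]; positivity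
  set p : ℝ := k / 2 with hp
  have hp1 : 1 ≤ p := by rw [hp]; linarith
  have hp0 : 0 < p := by linarith
  have hpi : (2 / k : ℝ) = p⁻¹ := by rw [hp, inv_div]
  have hS : 0 ≤ ∑ n ∈ A, (n.divisors.card : ℝ) ^ 2 :=
    Finset.sum_nonneg fun n _ => sq_nonneg _
  rw [hpi, ← Real.rpow_le_rpow_iff hS (by positivity) hp0]
  calc (∑ n ∈ A, (n.divisors.card : ℝ) ^ 2) ^ p
      ≤ (A.card : ℝ) ^ (p - 1) * ∑ n ∈ A, ((n.divisors.card : ℝ) ^ 2) ^ p :=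
        Real.rpow_sum_le_const_mul_sum_rpow_of_nonneg A hp1 fun n _ =>
          sq_nonneg (n.divisors.card : ℝ)
    _ = (A.card : ℝ) ^ (p - 1) * ∑ n ∈ A, (n.divisors.card : ℝ) ^ k := by
        congr 1
        refine Finset.sum_congr rfl fun n _ => ?_
        rw [← Real.rpow_natCast _ 2, ← Real.rpow_mul (by positivity), ← Real.rpow_natCast _ k]
        congr 1
        rw [hp]; push_cast; ring
    _ ≤ (A.card : ℝ) ^ (p - 1) * (N * (1 + Real.log N) ^ (2 ^ k)) := by
        gcongr
        exact (Finset.sum_le_sum_of_subset_of_nonneg hA fun n _ _ =>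
          pow_nonneg (Nat.cast_nonneg n.divisors.card) k).trans
          (sum_card_divisors_pow_le N k)
    _ = (A.card * α ^ (-p⁻¹) * (1 + Real.log N) ^ ((2 : ℝ) ^ k * p⁻¹)) ^ p := by
        rw [Real.mul_rpow (by positivity) (by positivity),
          Real.mul_rpow (by positivity) (by positivity), ← Real.rpow_mul hα.le,
          ← Real.rpow_mul (by positivity), neg_mul, inv_mul_cancel₀ hp0.ne',
          inv_mul_cancel_right₀ hp0.ne', Real.rpow_neg_one, Real.rpow_sub_one hA0.ne',
          ← Real.rpow_natCast (1 + Real.log N)]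
        push_cast
        rw [hAα]
        field_simp

/-- Cauchy–Schwarz bound for the union of the multiples in `A` of elements of `𝔇`. -/
theorem sq_mul_card_le_card_biUnion_mul {A 𝔇 : Finset ℕ} (hA : ∀ n ∈ A, n ≠ 0) {δ : ℝ}
    (hδ : 0 ≤ δ)
    (h : ∀ d ∈ 𝔇, δ * (A.card : ℝ) ≤ ((A.filter (fun n => d ∣ n)).card : ℝ)) :
    (δ * 𝔇.card * A.card) ^ 2 ≤ ((𝔇.biUnion (fun d => A.filter (fun n => d ∣ n))).card : ℝ) *
      ∑ n ∈ A, (n.divisors.card : ℝ) ^ 2 := by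
  set B := 𝔇.biUnion (fun d => A.filter (fun n => d ∣ n)) with hB
  have hBA : B ⊆ A := Finset.biUnion_subset.2 fun d _ => Finset.filter_subset _ _
  have hsum : δ * 𝔇.card * A.card ≤ ∑ n ∈ B, (n.divisors.card : ℝ) := by
    calc δ * 𝔇.card * A.card = ∑ d ∈ 𝔇, δ * (A.card : ℝ) := by
          rw [Finset.sum_const, nsmul_eq_mul]; ring
      _ ≤ ∑ d ∈ 𝔇, ((B.filter (fun n => d ∣ n)).card : ℝ) := by
          refine Finset.sum_le_sum fun d hd => (h d hd).trans ?_
          refine Nat.cast_le.2 (Finset.card_le_card fun n hn => ?_)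
          exact Finset.mem_filter.2
            ⟨Finset.mem_biUnion.2 ⟨d, hd, hn⟩, (Finset.mem_filter.1 hn).2⟩
      _ = ∑ n ∈ B, ((𝔇.filter (fun d => d ∣ n)).card : ℝ) := by
          exact_mod_cast Finset.sum_card_bipartiteAbove_eq_sum_card_bipartiteBelow
            (fun d n : ℕ => d ∣ n)
      _ ≤ ∑ n ∈ B, (n.divisors.card : ℝ) := by
          refine Finset.sum_le_sum fun n hn => ?_
          gcongr
          intro d hd
          exact Nat.mem_divisors.2 ⟨(Finset.mem_filter.1 hd).2, hA n (hBA hn)⟩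
  calc (δ * 𝔇.card * A.card) ^ 2 ≤ (∑ n ∈ B, (n.divisors.card : ℝ)) ^ 2 := by gcongr
    _ ≤ B.card * ∑ n ∈ B, (n.divisors.card : ℝ) ^ 2 := sq_sum_le_card_mul_sum_sq
    _ ≤ B.card * ∑ n ∈ A, (n.divisors.card : ℝ) ^ 2 := by
        gcongr

/-- Divisor packing lemma (Lemma C.2).  For every `0 < κ < 1/2` there is `c_κ > 0` such that:
if `N ≥ 2`, `A ⊆ [N]` is nonempty with `|A| = αN`, and `𝔇` is a finite set of positive
integers with `|A_d| ≥ δ|A|` for all `d ∈ 𝔇` (where `A_d := {n ∈ A : d ∣ n}`) and some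
`δ > 0`, then `|⋃_{d ∈ 𝔇} A_d| ≥ c_κ δ² |𝔇|² |A| α^κ (log N)^{-2^{2/κ}}`. -/
theorem divisor_packing (κ : ℝ) (hκ0 : 0 < κ) (hκ1 : κ < 1 / 2) :
    ∃ c : ℝ, 0 < c ∧ ∀ N : ℕ, 2 ≤ N →
      ∀ A : Finset ℕ, A ⊆ Finset.Icc 1 N → A.Nonempty →
      ∀ α : ℝ, (A.card : ℝ) = α * N →
      ∀ δ : ℝ, 0 < δ →
      ∀ 𝔇 : Finset ℕ, (∀ d ∈ 𝔇, 0 < d) →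
      (∀ d ∈ 𝔇, δ * (A.card : ℝ) ≤ ((A.filter (fun n => d ∣ n)).card : ℝ)) →
      c * δ ^ 2 * (𝔇.card : ℝ) ^ 2 * (A.card : ℝ) * α ^ κ *
          Real.log N ^ (-((2 : ℝ) ^ (2 / κ))) ≤
        ((𝔇.biUnion (fun d => A.filter (fun n => d ∣ n))).card : ℝ) := by
  set E : ℝ := (2 : ℝ) ^ (2 / κ) with hE
  refine ⟨3 ^ (-E), by positivity, ?_⟩
  intro N hN A hA hne α hAα δ hδ 𝔇 _ hd
  have hN0 : (0 : ℝ) < N := by exact_mod_cast (by omega : 0 < N)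
  have hA0 : (0 : ℝ) < A.card := by exact_mod_cast hne.card_pos
  have hα : 0 < α := by
    rw [hAα] at hA0
    exact pos_of_mul_pos_left hA0 hN0.le
  have hα1 : α ≤ 1 := by
    have h1 : (A.card : ℝ) ≤ N := by exact_mod_cast (Finset.card_le_card hA).trans (by simp)
    rw [hAα] at h1
    exact le_of_mul_le_mul_right (by linarith) hN0
  have hlog : 1 / 2 ≤ Real.log N := by
    have h2 : Real.log 2 ≤ Real.log N := Real.log_le_log (by norm_num) (by exact_mod_cast hN)
    linarith [Real.log_two_gt_d9]
  set k : ℕ := ⌈2 / κ⌉₊ with hk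
  have hκ4 : 4 < 2 / κ := by rw [lt_div_iff₀ hκ0]; linarith
  have hkge : 2 / κ ≤ k := Nat.le_ceil _
  have hklt : (k : ℝ) < 2 / κ + 1 := Nat.ceil_lt_add_one (by positivity)
  have hk5 : 5 ≤ k := by
    have : (4 : ℝ) < k := hκ4.trans_le hkge
    exact_mod_cast this
  have hk5' : (5 : ℝ) ≤ k := by exact_mod_cast hk5
  have hkκ : 2 / (k : ℝ) ≤ κ := by
    rw [div_le_iff₀ hκ0] at hkge
    rw [div_le_iff₀ (by linarith)]
    linarith
  have hexp : (2 : ℝ) ^ k * (2 / k) ≤ E := by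
    have h1 : (2 : ℝ) ^ k ≤ E * 2 := by
      rw [hE, ← Real.rpow_natCast, ← Real.rpow_add_one (by norm_num)]
      exact Real.rpow_le_rpow_of_exponent_le (by norm_num) hklt.le
    have h2 : (2 : ℝ) / k ≤ 1 / 2 := by
      rw [div_le_div_iff₀ (by linarith) (by norm_num)]
      linarith
    calc (2 : ℝ) ^ k * (2 / k) ≤ E * 2 * (1 / 2) := by gcongr
      _ = E := by ring
  have hS : ∑ n ∈ A, (n.divisors.card : ℝ) ^ 2 ≤
      A.card * α ^ (-κ) * (3 * Real.log N) ^ E := by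
    refine (sum_card_divisors_sq_le (by omega) (by omega) hA hα hAα (k := k)).trans ?_
    have h1 : α ^ (-(2 / k : ℝ)) ≤ α ^ (-κ) :=
      Real.rpow_le_rpow_of_exponent_ge hα hα1 (by linarith)
    have h2 : (1 + Real.log N) ^ ((2 : ℝ) ^ k * (2 / k)) ≤ (3 * Real.log N) ^ E :=
      (Real.rpow_le_rpow_of_exponent_le (by linarith) hexp).trans
        (Real.rpow_le_rpow (by linarith) (by linarith) (by positivity))
    gcongr
  have hmain := sq_mul_card_le_card_biUnion_mul
    (fun n hn => Nat.one_le_iff_ne_zero.1 (Finset.mem_Icc.1 (hA hn)).1) hδ.le hd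
  set b : ℝ := ((𝔇.biUnion (fun d => A.filter (fun n => d ∣ n))).card : ℝ)
  have hb : 0 ≤ b := Nat.cast_nonneg _
  have hbound := hmain.trans (mul_le_mul_of_nonneg_left hS hb)
  have hlog0 : 0 < Real.log N := by linarith
  rw [Real.mul_rpow (by norm_num) hlog0.le, Real.rpow_neg hα.le] at hbound
  rw [Real.rpow_neg hlog0.le, Real.rpow_neg (by norm_num)]
  have hx : 0 < α ^ κ := by positivity
  have hy : 0 < Real.log N ^ E := by positivity
  have hz : (0 : ℝ) < 3 ^ E := by positivity
  generalize α ^ κ = x at *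
  generalize Real.log N ^ E = y at *
  generalize (3 : ℝ) ^ E = z at *
  calc z⁻¹ * δ ^ 2 * (𝔇.card : ℝ) ^ 2 * A.card * x * y⁻¹
      = (δ * 𝔇.card * A.card) ^ 2 * (x / (A.card * z * y)) := by field_simp
    _ ≤ b * (A.card * x⁻¹ * (z * y)) * (x / (A.card * z * y)) := by gcongr
    _ = b := by field_simp
end
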